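/- Let T' ⊆ T be perfect trees with canonical term sequences t̄' and t̄ respectively. Then t̄' ≤ t̄ in S*: there is a substitution φ with t̄' = t̄∘φ such that each φ_i depends only on the variables x_j with j ≤ i and each variable x_j is determined by some finite subfamily of the φ_i. -/

import Mathlib

open Classical

/-- `t` is a splitting node of `T`: both immediate successors of `t` belong to `T`. -/
def SplitNode (T : Set (List Bool)) (t : List Bool) : Prop :=
  t ∈ T ∧ t.concat false ∈ T ∧ t.concat true ∈ T

/-- A perfect tree: a nonempty set of finite binary sequences, closed under initial
segments, in which every node has a splitting node extending it. -/
def PerfectTree (T : Set (List Bool)) : Prop :=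
  T.Nonempty ∧ (∀ s t : List Bool, s <+: t → t ∈ T → s ∈ T) ∧
    (∀ t ∈ T, ∃ s, t <+: s ∧ SplitNode T s)

/-- The number of splitting nodes of `T` that are proper initial segments of `t`. -/
noncomputable def splitIdx (T : Set (List Bool)) (t : List Bool) : ℕ :=
  {s | SplitNode T s ∧ s <+: t ∧ s ≠ t}.ncard

/-- The initial segment of length `n` of the branch `b_a` of `T` determined by the
assignment `a`. -/
noncomputable def branchNode (T : Set (List Bool)) (a : ℕ → Bool) : ℕ → List Bool
  | 0 => []
  | n + 1 =>
      (branchNode T a n).concat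
        (if SplitNode T (branchNode T a n) then a (splitIdx T (branchNode T a n))
         else if (branchNode T a n).concat true ∈ T then true else false)

/-- The canonical term sequence of `T`:  `canonTerm T n a = b_a(n)`. -/
noncomputable def canonTerm (T : Set (List Bool)) (n : ℕ) (a : ℕ → Bool) : Bool :=
  (branchNode T a (n + 1)).getLastD false

/-- `t` depends only on the variables `x_j` with `j ∈ Y`. -/
def DependsOnly (t : (ℕ → Bool) → Bool) (Y : Set ℕ) : Prop :=
  ∀ a b : ℕ → Bool, (∀ j ∈ Y, a j = b j) → t a = t b

/-- A term: a function of the assignments depending only on finitely many variables. -/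
def IsTerm (t : (ℕ → Bool) → Bool) : Prop :=
  ∃ Y : Finset ℕ, DependsOnly t ↑Y

/-- The variable `x_j` is determined by the finite family of terms `(t k)_{k ∈ K}`. -/
def Determines (t : ℕ → (ℕ → Bool) → Bool) (K : Finset ℕ) (j : ℕ) : Prop :=
  ∀ a b : ℕ → Bool, (∀ k ∈ K, t k a = t k b) → a j = b j

/-- `S*`: sequences of terms `t̄` such that `t i` depends only on variables `x_j`
with `j ≤ i` and each variable `x_j` is determined by finitely many of the `t i`. -/
def InSStar (t : ℕ → (ℕ → Bool) → Bool) : Prop :=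
  (∀ i, DependsOnly (t i) {j | j ≤ i}) ∧ (∀ j, ∃ K : Finset ℕ, Determines t K j)

/-- Application of the substitution `φ` to the term `t`: `(t∘φ)(a) = t(i ↦ φ_i(a))`. -/
def substTerm (t : (ℕ → Bool) → Bool) (φ : ℕ → (ℕ → Bool) → Bool) :
    (ℕ → Bool) → Bool :=
  fun a => t fun i => φ i a

/-- The order on `S*`:  `t' ≤ t` iff `t' = t∘φ` for a substitution `φ` such that each
`φ_i` depends only on variables `x_j` with `j ≤ i` and each variable `x_j` is
determined by finitely many of the `φ_i`. -/
def SLE (t' t : ℕ → (ℕ → Bool) → Bool) : Prop :=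
  ∃ φ : ℕ → (ℕ → Bool) → Bool,
    (∀ i, t' i = substTerm (t i) φ) ∧
    (∀ i, DependsOnly (φ i) {j | j ≤ i}) ∧
    (∀ j, ∃ K : Finset ℕ, Determines φ K j)

lemma finite_proper_split_prefixes (T : Set (List Bool)) (t : List Bool) :
    {s | SplitNode T s ∧ s <+: t ∧ s ≠ t}.Finite := by
  refine (t.inits.toFinset.finite_toSet).subset ?_
  rintro s ⟨-, h, -⟩
  simpa using h

lemma splitIdx_nil (T : Set (List Bool)) : splitIdx T [] = 0 := by
  simp [splitIdx]

lemma splitIdx_concat (T : Set (List Bool)) (t : List Bool) (x : Bool) :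
    splitIdx T (t.concat x) = splitIdx T t + if SplitNode T t then 1 else 0 := by
  have hpre : ∀ s, (s <+: t.concat x ∧ s ≠ t.concat x) ↔ s <+: t := by
    intro s
    simp only [List.concat_eq_append, List.prefix_concat_iff]
    constructor
    · rintro ⟨h | h, h'⟩
      · exact absurd h h'
      · exact h
    · intro h
      refine ⟨Or.inr h, ?_⟩
      rintro rfl
      simpa using h.length_le
  by_cases h : SplitNode T t
  · have hset : {s | SplitNode T s ∧ s <+: t.concat x ∧ s ≠ t.concat x} =
        insert t {s | SplitNode T s ∧ s <+: t ∧ s ≠ t} := by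
      ext s
      simp only [Set.mem_ofPred_eq, Set.mem_insert_iff, hpre]
      constructor
      · rintro ⟨h1, h2⟩
        by_cases hs : s = t
        · exact Or.inl hs
        · exact Or.inr ⟨h1, h2, hs⟩
      · rintro (rfl | ⟨h1, h2, -⟩)
        · exact ⟨h, List.prefix_rfl⟩
        · exact ⟨h1, h2⟩
    rw [splitIdx, hset, Set.ncard_insert_of_notMem (by simp) (finite_proper_split_prefixes T t)]
    simp [splitIdx, h]
  · have hset : {s | SplitNode T s ∧ s <+: t.concat x ∧ s ≠ t.concat x} =
        {s | SplitNode T s ∧ s <+: t ∧ s ≠ t} := by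
      ext s
      simp only [Set.mem_ofPred_eq, hpre]
      constructor
      · rintro ⟨h1, h2⟩
        exact ⟨h1, h2, fun hs => h (hs ▸ h1)⟩
      · rintro ⟨h1, h2, -⟩
        exact ⟨h1, h2⟩
    rw [splitIdx, hset]
    simp [splitIdx, h]

lemma SplitNode.mono {T T' : Set (List Bool)} (hsub : T' ⊆ T) {t : List Bool}
    (h : SplitNode T' t) : SplitNode T t :=
  ⟨hsub h.1, hsub h.2.1, hsub h.2.2⟩

lemma splitIdx_mono {T T' : Set (List Bool)} (hsub : T' ⊆ T) (t : List Bool) :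
    splitIdx T' t ≤ splitIdx T t :=
  Set.ncard_le_ncard (fun _ hs => ⟨hs.1.mono hsub, hs.2⟩) (finite_proper_split_prefixes T t)

/-- The bit by which the branch of `T` determined by `a` continues at level `n`. -/
noncomputable def branchBit (T : Set (List Bool)) (a : ℕ → Bool) (n : ℕ) : Bool :=
  if SplitNode T (branchNode T a n) then a (splitIdx T (branchNode T a n))
  else if (branchNode T a n).concat true ∈ T then true else false

lemma branchNode_succ (T : Set (List Bool)) (a : ℕ → Bool) (n : ℕ) :
    branchNode T a (n + 1) = (branchNode T a n).concat (branchBit T a n) := rfl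

lemma length_branchNode (T : Set (List Bool)) (a : ℕ → Bool) (n : ℕ) :
    (branchNode T a n).length = n := by
  induction n with
  | zero => rfl
  | succ n ih => simp [branchNode_succ, ih]

lemma splitIdx_branchNode_succ (S T : Set (List Bool)) (a : ℕ → Bool) (n : ℕ) :
    splitIdx S (branchNode T a (n + 1)) = splitIdx S (branchNode T a n) +
      if SplitNode S (branchNode T a n) then 1 else 0 := by
  rw [branchNode_succ, splitIdx_concat]

lemma monotone_splitIdx_branchNode (S T : Set (List Bool)) (a : ℕ → Bool) :
    Monotone fun n => splitIdx S (branchNode T a n) :=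
  monotone_nat_of_le_succ fun n => by
    rw [splitIdx_branchNode_succ]
    exact Nat.le_add_right _ _

lemma splitIdx_branchNode_le (S T : Set (List Bool)) (a : ℕ → Bool) (n : ℕ) :
    splitIdx S (branchNode T a n) ≤ n := by
  induction n with
  | zero => simp [branchNode, splitIdx_nil]
  | succ n ih =>
    rw [splitIdx_branchNode_succ]
    split_ifs <;> omega

lemma splitIdx_branchNode_lt {S T : Set (List Bool)} {a : ℕ → Bool} {m n : ℕ} (hmn : m < n)
    (h : SplitNode S (branchNode T a m)) :
    splitIdx S (branchNode T a m) < splitIdx S (branchNode T a n) := by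
  have h1 := monotone_splitIdx_branchNode S T a (Nat.succ_le_of_lt hmn)
  have h2 := splitIdx_branchNode_succ S T a m
  simp only [h, if_true] at h2
  simp only [Nat.succ_eq_add_one] at h1
  omega

lemma level_eq_of_splitIdx_eq {S T : Set (List Bool)} {a : ℕ → Bool} {m n : ℕ}
    (hm : SplitNode S (branchNode T a m)) (hn : SplitNode S (branchNode T a n))
    (h : splitIdx S (branchNode T a m) = splitIdx S (branchNode T a n)) : m = n := by
  rcases lt_trichotomy m n with hlt | heq | hlt
  · exact absurd h (splitIdx_branchNode_lt hlt hm).ne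
  · exact heq
  · exact absurd h (splitIdx_branchNode_lt hlt hn).ne'

lemma exists_concat_prefix {t s : List Bool} (h : t <+: s) (hne : t ≠ s) :
    ∃ x, t.concat x <+: s := by
  obtain ⟨u, rfl⟩ := h
  cases u with
  | nil => simp at hne
  | cons x u => exact ⟨x, u, by simp⟩

lemma branchBit_eq_of_not_split {T : Set (List Bool)} {a : ℕ → Bool} {n : ℕ} {x : Bool}
    (hmem : branchNode T a n ∈ T) (hsplit : ¬ SplitNode T (branchNode T a n))
    (hx : (branchNode T a n).concat x ∈ T) : branchBit T a n = x := by
  rw [branchBit, if_neg hsplit]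
  cases x with
  | true => rw [if_pos hx]
  | false => rw [if_neg fun h => hsplit ⟨hmem, hx, h⟩]

lemma PerfectTree.branchNode_mem {T : Set (List Bool)} (hT : PerfectTree T) (a : ℕ → Bool)
    (n : ℕ) : branchNode T a n ∈ T := by
  induction n with
  | zero =>
    obtain ⟨t, ht⟩ := hT.1
    exact hT.2.1 [] t List.nil_prefix ht
  | succ n ih =>
    rw [branchNode_succ]
    by_cases h : SplitNode T (branchNode T a n)
    · cases branchBit T a n
      · exact h.2.1
      · exact h.2.2
    · obtain ⟨s, hs, hss⟩ := hT.2.2 _ ih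
      obtain ⟨x, hx⟩ := exists_concat_prefix hs fun he => h (he ▸ hss)
      have hxT := hT.2.1 _ _ hx hss.1
      rwa [branchBit_eq_of_not_split ih h hxT]

/-- As long as it meets no splitting node, a branch of `T` runs along any given node of `T`
above its starting point. -/
lemma PerfectTree.prefix_or_splitIdx_lt {T : Set (List Bool)} (hT : PerfectTree T)
    (a : ℕ → Bool) {n : ℕ} {s : List Bool} (hs : branchNode T a n <+: s) (hsplit : SplitNode T s)
    (m : ℕ) : branchNode T a (n + m) <+: s ∨
      splitIdx T (branchNode T a n) < splitIdx T (branchNode T a (n + m)) := by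
  induction m with
  | zero => exact Or.inl hs
  | succ m ih =>
    rcases ih with ih | ih
    · by_cases h : SplitNode T (branchNode T a (n + m))
      · right
        refine lt_of_le_of_lt (monotone_splitIdx_branchNode T T a (Nat.le_add_right n m)) ?_
        exact splitIdx_branchNode_lt (by omega) h
      · left
        obtain ⟨x, hx⟩ := exists_concat_prefix ih fun he => h (he ▸ hsplit)
        have hxT := hT.2.1 _ _ hx hsplit.1
        rw [← add_assoc, branchNode_succ,
          branchBit_eq_of_not_split (hT.branchNode_mem a _) h hxT]
        exact hx
    · exact Or.inr (lt_of_lt_of_le ih (monotone_splitIdx_branchNode T T a (by omega)))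

/-- All branches of a perfect tree pass their `j`-th splitting node below a common level. -/
lemma PerfectTree.exists_level_splitIdx_ge {T : Set (List Bool)} (hT : PerfectTree T) (j : ℕ) :
    ∃ N, ∀ a, j ≤ splitIdx T (branchNode T a N) := by
  induction j with
  | zero => exact ⟨0, fun _ => Nat.zero_le _⟩
  | succ j ih =>
    obtain ⟨N, hN⟩ := ih
    choose f hf hf' using hT.2.2
    have hfin : {l : List Bool | l.length = N}.Finite := List.finite_length_eq Bool N
    obtain ⟨M, hM⟩ := (hfin.image fun l => if h : l ∈ T then (f l h).length else 0).bddAbove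
    refine ⟨N + (M + 1), fun a => ?_⟩
    have hmem := hT.branchNode_mem a N
    have hlen : (f _ hmem).length ≤ M :=
      hM ⟨branchNode T a N, length_branchNode T a N, by simp [hmem]⟩
    rcases hT.prefix_or_splitIdx_lt a (hf _ hmem) (hf' _ hmem) (M + 1) with h | h
    · have := h.length_le
      rw [length_branchNode] at this
      omega
    · exact lt_of_le_of_lt (hN a) h

lemma branchNode_congr {T : Set (List Bool)} {a b : ℕ → Bool} {n : ℕ}
    (h : ∀ m < n, a (splitIdx T (branchNode T a m)) = b (splitIdx T (branchNode T a m))) :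
    branchNode T a n = branchNode T b n := by
  induction n with
  | zero => rfl
  | succ n ih =>
    have hn := ih fun m hm => h m (by omega)
    rw [branchNode_succ, branchNode_succ, branchBit, branchBit, ← hn, h n (by omega)]

lemma eq_of_branchNode_eq {T : Set (List Bool)} {a b : ℕ → Bool} {n j : ℕ}
    (h : branchNode T a n = branchNode T b n) (hj : j < splitIdx T (branchNode T a n)) :
    a j = b j := by
  induction n with
  | zero => simp [branchNode, splitIdx_nil] at hj
  | succ n ih =>
    rw [branchNode_succ, branchNode_succ, List.concat_eq_append, List.concat_eq_append] at h
    obtain ⟨hn, hbit⟩ := List.append_inj' h rfl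
    by_cases hlt : j < splitIdx T (branchNode T a n)
    · exact ih hn hlt
    · rw [splitIdx_branchNode_succ] at hj
      by_cases hs : SplitNode T (branchNode T a n)
      · rw [if_pos hs] at hj
        have hidx : splitIdx T (branchNode T a n) = j := by omega
        simp only [branchBit, ← hn, if_pos hs, hidx] at hbit
        simpa using hbit
      · rw [if_neg hs] at hj
        omega

/-- The substitution witnessing `T' ⊆ T`: its `i`-th term is the direction which the branch of
`T'` takes at the `i`-th splitting node of `T` it meets. -/
noncomputable def subtreeSubst (T T' : Set (List Bool)) (i : ℕ) (a : ℕ → Bool) : Bool :=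
  decide (∃ n, SplitNode T (branchNode T' a n) ∧ splitIdx T (branchNode T' a n) = i ∧
    branchBit T' a n = true)

lemma subtreeSubst_splitIdx {T T' : Set (List Bool)} {a : ℕ → Bool} {n : ℕ}
    (h : SplitNode T (branchNode T' a n)) :
    subtreeSubst T T' (splitIdx T (branchNode T' a n)) a = branchBit T' a n := by
  rw [subtreeSubst, Bool.eq_iff_iff, decide_eq_true_iff]
  constructor
  · rintro ⟨m, hm, hidx, hbit⟩
    rwa [← level_eq_of_splitIdx_eq hm h hidx]
  · exact fun hbit => ⟨n, h, rfl, hbit⟩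

lemma branchNode_subtreeSubst {T T' : Set (List Bool)} (hT' : PerfectTree T') (hsub : T' ⊆ T)
    (a : ℕ → Bool) (n : ℕ) :
    branchNode T (fun i => subtreeSubst T T' i a) n = branchNode T' a n := by
  induction n with
  | zero => rfl
  | succ n ih =>
    rw [branchNode_succ, branchNode_succ, ih]
    congr 1
    by_cases h : SplitNode T (branchNode T' a n)
    · rw [branchBit, ih, if_pos h, subtreeSubst_splitIdx h]
    · refine branchBit_eq_of_not_split ?_ ?_ ?_ <;> rw [ih]
      · exact hsub (hT'.branchNode_mem a n)
      · exact h
      · exact hsub (hT'.branchNode_mem a (n + 1))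

lemma dependsOnly_subtreeSubst {T T' : Set (List Bool)} (hsub : T' ⊆ T) (i : ℕ) :
    DependsOnly (subtreeSubst T T' i) {j | j ≤ i} := by
  have key : ∀ a b : ℕ → Bool, (∀ j ∈ {j | j ≤ i}, a j = b j) →
      subtreeSubst T T' i a = true → subtreeSubst T T' i b = true := by
    intro a b hab
    simp only [subtreeSubst, decide_eq_true_iff]
    rintro ⟨n, hn, hidx, hbit⟩
    have hle : ∀ m ≤ n, splitIdx T' (branchNode T' a m) ≤ i := fun m hm =>
      ((splitIdx_mono hsub _).trans (monotone_splitIdx_branchNode T T' a hm)).trans hidx.le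
    have heq : branchNode T' a n = branchNode T' b n :=
      branchNode_congr fun m hm => hab _ (hle m hm.le)
    refine ⟨n, heq ▸ hn, heq ▸ hidx, ?_⟩
    rw [← hbit, branchBit, branchBit, ← heq, hab _ (hle n le_rfl)]
  intro a b hab
  rw [Bool.eq_iff_iff]
  exact ⟨key a b hab, key b a fun j hj => (hab j hj).symm⟩

lemma exists_determines_subtreeSubst {T T' : Set (List Bool)} (hT' : PerfectTree T')
    (hsub : T' ⊆ T) (j : ℕ) : ∃ K : Finset ℕ, Determines (subtreeSubst T T') K j := by
  obtain ⟨N, hN⟩ := hT'.exists_level_splitIdx_ge (j + 1)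
  refine ⟨Finset.range N, fun a b hab => eq_of_branchNode_eq (T := T') (n := N) ?_ (hN a)⟩
  rw [← branchNode_subtreeSubst hT' hsub a, ← branchNode_subtreeSubst hT' hsub b]
  exact branchNode_congr fun m hm =>
    hab _ (Finset.mem_range.2 ((splitIdx_branchNode_le T T _ m).trans_lt hm))

/-- If `T' ⊆ T` are perfect trees, then the canonical term sequence of `T'` is
stronger than that of `T` in `S*`: there is a substitution `φ` with `t̄' = t̄∘φ`,
each `φ_i` depending only on variables `x_j` with `j ≤ i`, and each variable `x_j`
determined by finitely many of the `φ_i`. -/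
theorem canonTerm_subtree_le (T T' : Set (List Bool))
    (hT : PerfectTree T) (hT' : PerfectTree T') (hsub : T' ⊆ T) :
    SLE (fun n => canonTerm T' n) (fun n => canonTerm T n) := by
  refine ⟨subtreeSubst T T', fun n => ?_, dependsOnly_subtreeSubst hsub,
    exists_determines_subtreeSubst hT' hsub⟩
  funext a
  simp only [substTerm, canonTerm, branchNode_subtreeSubst hT' hsub]
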